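/- Fix an integer n ≥ 2 and set w = (1−n, 1, …, 1) ∈ ℤ^n. For s as below define κ'(s) = (1/n)·(−v(s_*) + max_{2≤i≤n} log_q(2^{ω(s_i)}·max{1, ln(ln|s_i|)}/|s_i|)). There exists a constant c₂ ≥ 1 such that for every s = (s_2,…,s_n) ∈ (R_v ∖ {0})^{n−1} satisfying the divisibility-chain condition with v(s_*) ∈ nℤ, every k ∈ ◊_s, every integer N ≥ 1 with k + (N−1)w ∈ ◊_s, and every integer m ≥ 1 with N ≥ κ'(s)/(c₂·q^{−mn}), one has Card{ (t, j) ∈ Λ_s × {0,…,N−1} : there exists λ ∈ R_v^n ∖ {0} with ‖exp(k + j·w)·u_t·λ‖ ≤ q^{−m} } ≤ 2·c₂·q^{−mn}·N·Card Λ_s. -/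

import Mathlib

noncomputable section

open Polynomial
open scoped Classical

variable (Fq : Type) [Field Fq] [Fintype Fq]

/-- `K_v = F_q((Y⁻¹))`, realized as the field of Laurent series over `F_q`
in the uniformizer `π_v = Y⁻¹`. -/
abbrev Kv := LaurentSeries Fq

/-- The uniformizer `π_v = Y⁻¹` of `K_v`. -/
def piv : Kv Fq := HahnSeries.single (1 : ℤ) (1 : Fq)

/-- The element `Y = π_v⁻¹ ∈ K_v`. -/
def Yv : Kv Fq := HahnSeries.single (-1 : ℤ) (1 : Fq)

/-- The embedding `R_v = F_q[Y] → K_v`, `f ↦ f(Y)`. -/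
def polyEmb : Polynomial Fq →+* Kv Fq := Polynomial.eval₂RingHom HahnSeries.C (Yv Fq)

/-- `R_v = F_q[Y]`, as a subring of `K_v`. -/
def Rv : Subring (Kv Fq) := (polyEmb Fq).range

/-- `K = F_q(Y)`, the fraction field of `R_v`, as a subfield of `K_v`. -/
def Ksub : Subfield (Kv Fq) := Subfield.closure (Rv Fq : Set (Kv Fq))

/-- The normalized absolute value `|x| = q^{-v(x)}` on `K_v`, where `q = Card F_q`. -/
def absv (x : Kv Fq) : ℝ := if x = 0 then 0 else (Fintype.card Fq : ℝ) ^ (-x.order)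

/-- `x ∈ π_v^ℓ O_v`. -/
def inPiPow (ℓ : ℤ) (x : Kv Fq) : Prop := x = 0 ∨ ℓ ≤ x.order

variable (n : ℕ)

/-- The sup norm `‖x‖ = max_i |x_i|` on `K_v^n`. -/
def vnorm (x : Fin n → Kv Fq) : ℝ := ⨆ i, absv Fq (x i)

/-- The `R_v`-lattice `g R_v^n` in `K_v^n` associated with a matrix `g`. -/
def latticeSet (g : Matrix (Fin n) (Fin n) (Kv Fq)) : Set (Fin n → Kv Fq) :=
  {x | ∃ p : Fin n → Polynomial Fq, x = g.mulVec fun i => polyEmb Fq (p i)}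

/-- `R_v^n` as a subset of `K_v^n`. -/
def RvN : Set (Fin n → Kv Fq) := {x | ∀ i, x i ∈ Rv Fq}

lemma absv_zero : absv Fq 0 = 0 := if_pos rfl

lemma absv_one : absv Fq 1 = 1 := by
  rw [absv, if_neg one_ne_zero, HahnSeries.order_one]
  simp

lemma absv_mul (x y : Kv Fq) : absv Fq (x * y) = absv Fq x * absv Fq y := by
  rcases eq_or_ne x 0 with rfl | hx
  · simp [absv]
  rcases eq_or_ne y 0 with rfl | hy
  · simp [absv]
  have hxy : x * y ≠ 0 := mul_ne_zero hx hy
  have hq : (0 : ℝ) < (Fintype.card Fq : ℝ) := by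
    exact_mod_cast Fintype.card_pos
  rw [absv, absv, absv, if_neg hxy, if_neg hx, if_neg hy,
    HahnSeries.order_mul hx hy, neg_add, zpow_add₀ (ne_of_gt hq)]

variable [NeZero n]

/-- The unipotent matrix `u_t ∈ SL_n(K_v)` with first column `(1, t_2, …, t_n)` and
`j`-th column `e_j` for `j ≥ 2`. -/
def uMat (t : Fin n → Kv Fq) : Matrix (Fin n) (Fin n) (Kv Fq) :=
  fun i j => if j = 0 then (if i = 0 then 1 else t i) else (if i = j then 1 else 0)

/-- The diagonal matrix `exp(k) = diag(π^{-k_1},…,π^{-k_n})`. -/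
def expD (k : Fin n → ℤ) : Matrix (Fin n) (Fin n) (Kv Fq) :=
  Matrix.diagonal fun i => piv Fq ^ (-(k i))

/-- The point `t = (r_2/s_2, …, r_n/s_n) ∈ K^{n-1} ⊆ K_v^{n-1}`. -/
def tOf (s r : Fin n → Polynomial Fq) : Fin n → Kv Fq :=
  fun i => if i = 0 then 0 else polyEmb Fq (r i) / polyEmb Fq (s i)

/-- The canonical set of representatives of
`Λ_s = {(r_2/s_2,…,r_n/s_n) mod R_v^{n-1} : r_i R_v + s_i R_v = R_v}`: the tuples
`r = (r_2,…,r_n)` with `r_i` coprime to `s_i` and `deg r_i < deg s_i`. -/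
def Tset (s : Fin n → Polynomial Fq) : Set (Fin n → Polynomial Fq) :=
  {r | r 0 = 0 ∧ ∀ i : Fin n, i ≠ 0 →
    IsCoprime (r i) (s i) ∧ (r i).degree < (s i).degree}

/-- `-v(s_*) = max_{2 ≤ i ≤ n} deg s_i`. -/
def degStar (s : Fin n → Polynomial Fq) : ℕ :=
  (Finset.univ.erase (0 : Fin n)).sup fun i => (s i).natDegree

/-- `v(s_*) = min_{2 ≤ i ≤ n} v(s_i)`. -/
def vstar (s : Fin n → Polynomial Fq) : ℤ := -(degStar Fq n s : ℤ)

/-- `Δ_s = {k ∈ ℤ₀^n : k_1 ≥ v(s_*), k_i ≥ 0 for i ≥ 2}`. -/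
def DeltaSet (s : Fin n → Polynomial Fq) : Set (Fin n → ℤ) :=
  {k | (∑ i, k i) = 0 ∧ vstar Fq n s ≤ k 0 ∧ ∀ i, i ≠ 0 → 0 ≤ k i}

/-- `◊_s = {k ∈ ℤ₀^n : 0 ≤ k_i ≤ k_1 - v(s_*) for i ≥ 2}`. -/
def diamondSet (s : Fin n → Polynomial Fq) : Set (Fin n → ℤ) :=
  {k | (∑ i, k i) = 0 ∧ ∀ i, i ≠ 0 → 0 ≤ k i ∧ k i ≤ k 0 - vstar Fq n s}

/-- The divisibility-chain condition: for some permutation `σ` of `{2,…,n}`,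
`s_{σ(2)} ∣ s_{σ(3)} ∣ … ∣ s_{σ(n)}`. -/
def ChainCond (s : Fin n → Polynomial Fq) : Prop :=
  ∃ σ : Equiv.Perm (Fin n), σ 0 = 0 ∧
    ∀ i j : Fin n, i ≠ 0 → j ≠ 0 → i ≤ j → s (σ i) ∣ s (σ j)

/-- `ω(f)`: the number of distinct monic irreducible factors of `f`. -/
def omegaP (f : Polynomial Fq) : ℕ :=
  (UniqueFactorizationMonoid.normalizedFactors f).toFinset.card

/-- The maximum of `f i` over `i ∈ {2,…,n}` (i.e. over `i ≠ 0`). -/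
def tailSup (hn : 2 ≤ n) (f : Fin n → ℝ) : ℝ :=
  (Finset.univ.erase (0 : Fin n)).sup'
    (by
      refine ⟨⟨1, by omega⟩, Finset.mem_erase.2 ⟨?_, Finset.mem_univ _⟩⟩
      simp [Fin.ext_iff])
    f

/-- The vector `w = (1-n, 1, …, 1) ∈ ℤ₀^n`. -/
def wvec : Fin n → ℤ := fun i => if i = 0 then 1 - (n : ℤ) else 1

/-- `κ'(s) = (1/n)(-v(s_*) + max_{2 ≤ i ≤ n} log_q(2^{ω(s_i)} max{1, ln ln |s_i|}/|s_i|))`. -/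
def kappa' (hn : 2 ≤ n) (s : Fin n → Polynomial Fq) : ℝ :=
  (1 / (n : ℝ)) * ((degStar Fq n s : ℝ) + tailSup n hn fun i =>
    Real.logb (Fintype.card Fq)
      ((2 : ℝ) ^ (omegaP Fq (s i)) *
          max 1 (Real.log (Real.log ((Fintype.card Fq : ℝ) ^ (s i).natDegree))) /
        (Fintype.card Fq : ℝ) ^ (s i).natDegree))

/-- The polynomials of degree less than `L`. -/
def polyBox (F : Type) [Field F] [Fintype F] (L : ℕ) : Finset F[X] :=
  (Finset.univ : Finset (Fin L → F)).map
    ((degreeLTEquiv F L).symm.toEquiv.toEmbedding.trans (Function.Embedding.subtype _))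

/-- A monic irreducible polynomial divides another only if they agree. -/
lemma eq_of_monic_irreducible_dvd {F : Type} [Field F] {p p' : F[X]} (hp : Irreducible p ∧ p.Monic)
    (hp' : Irreducible p' ∧ p'.Monic) (h : p ∣ p') : p = p' :=
  eq_of_monic_of_associated hp.2 hp'.2 (hp.1.associated_of_dvd hp'.1 h)

section Sieve

variable {F : Type} [Field F] [Fintype F]

lemma mem_polyBox {L : ℕ} {p : F[X]} : p ∈ polyBox F L ↔ p.degree < L := by
  rw [polyBox, Finset.mem_map, ← mem_degreeLT]
  constructor
  · rintro ⟨x, -, rfl⟩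
    exact ((degreeLTEquiv F L).symm x).2
  · intro hp
    exact ⟨degreeLTEquiv F L ⟨p, hp⟩, Finset.mem_univ _, by simp⟩

lemma card_polyBox (L : ℕ) : (polyBox F L).card = Fintype.card F ^ L := by
  simp [polyBox]

lemma one_lt_card_real : (1 : ℝ) < Fintype.card F := by
  exact_mod_cast Fintype.one_lt_card

/-- Distinct monic irreducible polynomials of degree less than `J` have total degree at most
`q ^ J`. -/
lemma sum_natDegree_le_card_pow (S : Finset F[X]) (hS : ∀ p ∈ S, Irreducible p ∧ p.Monic) (J : ℕ)
    (hJ : ∀ p ∈ S, p.natDegree < J) : ∑ p ∈ S, p.natDegree ≤ Fintype.card F ^ J := by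
  have hq : 1 < Fintype.card F := Fintype.one_lt_card
  have key : ∀ d : ℕ, ∑ p ∈ S with p.natDegree = d, p.natDegree ≤ Fintype.card F ^ d := by
    intro d
    rcases Nat.eq_zero_or_pos d with rfl | hd
    · rw [Finset.sum_eq_zero]
      · simp
      · intro p hp
        exact (Finset.mem_filter.1 hp).2
    rw [← natDegree_prod_of_monic _ _ fun p hp => (hS p (Finset.mem_filter.1 hp).1).2,
      ← FiniteField.X_pow_card_pow_sub_X_natDegree_eq F hd.ne' hq]
    refine natDegree_le_of_dvd (Finset.prod_dvd_of_coprime ?_ ?_)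
      (FiniteField.X_pow_card_pow_sub_X_ne_zero F hd.ne' hq)
    · intro p hp p' hp' hne
      have h1 := hS p (Finset.mem_filter.1 hp).1
      have h2 := hS p' (Finset.mem_filter.1 hp').1
      exact (h1.1.coprime_iff_not_dvd).2 fun h => hne (eq_of_monic_irreducible_dvd h1 h2 h)
    · intro p hp
      have h := Finset.mem_filter.1 hp
      have := (hS p h.1).1.natDegree_dvd_iff_dvd_X_pow_card_pow_sub_X (n := d)
      rw [Nat.card_eq_fintype_card] at this
      exact this.1 h.2.dvd
  have geom : ∀ J : ℕ, ∑ d ∈ Finset.range J, Fintype.card F ^ d ≤ Fintype.card F ^ J := by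
    intro J
    induction J with
    | zero => simp
    | succ J ih =>
      rw [Finset.sum_range_succ, pow_succ]
      nlinarith [Nat.pow_pos (n := J) (Nat.zero_lt_of_lt hq)]
  rw [← Finset.sum_fiberwise_of_maps_to (t := Finset.range J) (g := natDegree)
    fun p hp => Finset.mem_range.2 (hJ p hp)]
  exact (Finset.sum_le_sum fun d _ => key d).trans (geom J)

/-- The proportion of polynomials prime to `p`, for `p` irreducible. -/
def sieveFactor (p : F[X]) : ℝ := 1 - ((Fintype.card F : ℝ) ^ p.natDegree)⁻¹

lemma sieveFactor_nonneg (p : F[X]) : 0 ≤ sieveFactor p :=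
  sub_nonneg.2 (inv_le_one_of_one_le₀ (one_le_pow₀ one_lt_card_real.le))

/-- The Chinese remainder count of `z` of degree less than `L` with `u + v z` prime to all elements
of a finite set of irreducible polynomials. -/
lemma card_sieve (S : Finset F[X]) (hS : ∀ p ∈ S, Irreducible p ∧ p.Monic) :
    ∀ (u v : F[X]) (L : ℕ), (∀ p ∈ S, ¬ p ∣ v) → ∑ p ∈ S, p.natDegree ≤ L →
      (((polyBox F L).filter fun z => ∀ p ∈ S, ¬ p ∣ u + v * z).card : ℝ) =
        (Fintype.card F : ℝ) ^ L * ∏ p ∈ S, sieveFactor p := by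
  induction S using Finset.induction_on with
  | empty => intro u v L _ _; simp [card_polyBox]
  | insert p S hp ih =>
    intro u v L hv hL
    rw [Finset.sum_insert hp] at hL
    have hpi := hS p (Finset.mem_insert_self _ _)
    have hS' : ∀ p ∈ S, Irreducible p ∧ p.Monic := fun p' h => hS p' (Finset.mem_insert_of_mem h)
    have hv' : ∀ p ∈ S, ¬ p ∣ v := fun p' h => hv p' (Finset.mem_insert_of_mem h)
    have hp0 : p ≠ 0 := hpi.1.ne_zero
    obtain ⟨z₀, hz₀d, hz₀⟩ : ∃ z₀ : F[X], z₀.degree < p.degree ∧ p ∣ u + v * z₀ := by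
      obtain ⟨x, y, hxy⟩ := (hpi.1.coprime_iff_not_dvd).2 (hv p (Finset.mem_insert_self _ _))
      refine ⟨(-u * y) % p, EuclideanDomain.mod_lt _ hp0, ?_⟩
      have h1 := EuclideanDomain.div_add_mod (-u * y) p
      refine ⟨u * x - v * ((-u * y) / p), ?_⟩
      linear_combination u * hxy * (-1) + v * h1
    have hsplit : ((polyBox F L).filter fun z => ∀ p' ∈ insert p S, ¬ p' ∣ u + v * z) =
        ((polyBox F L).filter fun z => ∀ p' ∈ S, ¬ p' ∣ u + v * z).filter
          fun z => ¬ p ∣ u + v * z := by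
      ext z
      simp only [Finset.mem_filter, Finset.forall_mem_insert]
      tauto
    have hcount := Finset.card_filter_add_card_filter_not
      (s := (polyBox F L).filter fun z => ∀ p' ∈ S, ¬ p' ∣ u + v * z) (fun z => p ∣ u + v * z)
    have hbij : (((polyBox F L).filter fun z => ∀ p' ∈ S, ¬ p' ∣ u + v * z).filter
          fun z => p ∣ u + v * z).card =
        ((polyBox F (L - p.natDegree)).filter
          fun z => ∀ p' ∈ S, ¬ p' ∣ (u + v * z₀) + (v * p) * z).card := by
      symm
      refine Finset.card_bij (fun z _ => z₀ + p * z) ?_ ?_ ?_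
      · intro z hz
        rw [Finset.mem_filter, mem_polyBox] at hz
        rw [Finset.mem_filter, Finset.mem_filter, mem_polyBox]
        refine ⟨⟨?_, ?_⟩, ?_⟩
        · refine (degree_add_le _ _).trans_lt (max_lt ?_ ?_)
          · rw [degree_eq_natDegree hp0] at hz₀d
            exact hz₀d.trans_le (by exact_mod_cast (by omega : p.natDegree ≤ L))
          · by_cases hz0 : z = 0
            · simp [hz0]
            have := hz.1
            rw [degree_mul, degree_eq_natDegree hp0, degree_eq_natDegree hz0] at *
            norm_cast at *
            omega
        · intro p' hp'
          convert! hz.2 p' hp' using 2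
          ring
        · convert! dvd_add hz₀ (Dvd.intro_left (v * z) (rfl : v * z * p = _)) using 1
          ring
      · intro a _ b _ hab
        exact mul_left_cancel₀ hp0 (add_left_cancel hab)
      · intro z hz
        rw [Finset.mem_filter, Finset.mem_filter, mem_polyBox] at hz
        obtain ⟨⟨hzd, hzS⟩, hzp⟩ := hz
        have hdvd : p ∣ z - z₀ := by
          have h := dvd_sub hzp hz₀
          rw [show u + v * z - (u + v * z₀) = v * (z - z₀) by ring] at h
          exact (hpi.1.prime.dvd_or_dvd h).resolve_left (hv p (Finset.mem_insert_self _ _))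
        obtain ⟨z', hz'⟩ := hdvd
        have hz : z = z₀ + p * z' := by linear_combination hz'
        refine ⟨z', ?_, hz.symm⟩
        rw [Finset.mem_filter, mem_polyBox]
        constructor
        · by_cases hz0 : z' = 0
          · simp [hz0]
          have h1 : (p * z').degree < L := by
            rw [← hz']
            refine (degree_sub_le _ _).trans_lt (max_lt hzd ?_)
            rw [degree_eq_natDegree hp0] at hz₀d
            exact hz₀d.trans_le (by exact_mod_cast (by omega : p.natDegree ≤ L))
          rw [degree_mul, degree_eq_natDegree hp0, degree_eq_natDegree hz0] at h1
          rw [degree_eq_natDegree hz0]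
          norm_cast at *
          omega
        · intro p' hp'
          convert! hzS p' hp' using 2
          rw [hz]
          ring
    have h1 := ih hS' u v L hv' (by omega)
    have h2 := ih hS' (u + v * z₀) (v * p) (L - p.natDegree) (by
      intro p' hp' h
      rcases (hS' p' hp').1.prime.dvd_or_dvd h with h | h
      · exact hv' p' hp' h
      · exact hp (eq_of_monic_irreducible_dvd (hS' p' hp') hpi h ▸ hp')) (by omega)
    have hq : (Fintype.card F : ℝ) ≠ 0 := (zero_lt_one.trans one_lt_card_real).ne'
    rw [hsplit, Finset.prod_insert hp]
    rw [hbij] at hcount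
    have hcount' := congrArg (Nat.cast (R := ℝ)) hcount
    push_cast at hcount'
    rw [h1, h2, pow_sub₀ _ hq (by omega)] at hcount'
    rw [sieveFactor]
    linear_combination hcount'

lemma exp_neg_two_mul_le_one_sub {x : ℝ} (hx0 : 0 ≤ x) (hx : x ≤ 1 / 2) :
    Real.exp (-(2 * x)) ≤ 1 - x := by
  have h1 : 0 < 1 - x := by linarith
  rw [Real.exp_neg, inv_le_comm₀ (Real.exp_pos _) h1]
  calc (1 - x)⁻¹ ≤ 2 * x + 1 := by
        rw [inv_le_iff_one_le_mul₀ h1]; nlinarith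
    _ ≤ _ := Real.add_one_le_exp _

/-- The monic irreducible factors of `f`. -/
def primeSet (f : F[X]) : Finset F[X] :=
  (UniqueFactorizationMonoid.normalizedFactors f).toFinset

omit [Fintype F] in
lemma mem_primeSet {f p : F[X]} (hf : f ≠ 0) :
    p ∈ primeSet f ↔ Irreducible p ∧ p.Monic ∧ p ∣ f := by
  rw [primeSet, Multiset.mem_toFinset, Polynomial.mem_normalizedFactors_iff hf]

omit [Fintype F] in
lemma isCoprime_iff_primeSet {x f : F[X]} (hf : f ≠ 0) :
    IsCoprime x f ↔ ∀ p ∈ primeSet f, ¬ p ∣ x := by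
  constructor
  · intro h p hp hpx
    have := (mem_primeSet hf).1 hp
    exact this.1.not_isUnit (h.isUnit_of_dvd' hpx this.2.2)
  · intro h
    refine isCoprime_of_prime_dvd (fun h0 => hf h0.2) ?_
    intro z hz hzx hzf
    obtain ⟨p, hp, hzp⟩ :=
      UniqueFactorizationMonoid.exists_mem_normalizedFactors_of_dvd hf hz.irreducible hzf
    exact h p (Multiset.mem_toFinset.2 hp) (hzp.symm.dvd.trans hzx)

omit [Fintype F] in
lemma sum_natDegree_le_of_dvd {S : Finset F[X]} (hS : ∀ p ∈ S, Irreducible p ∧ p.Monic)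
    {g : F[X]} (hg : g ≠ 0) (h : ∀ p ∈ S, p ∣ g) : ∑ p ∈ S, p.natDegree ≤ g.natDegree := by
  rw [← natDegree_prod_of_monic _ _ fun p hp => (hS p hp).2]
  refine natDegree_le_of_dvd (Finset.prod_dvd_of_coprime ?_ h) hg
  intro p hp p' hp' hne
  exact ((hS p hp).1.coprime_iff_not_dvd).2
    fun h => hne (eq_of_monic_irreducible_dvd (hS p hp) (hS p' hp') h)

/-- The reduced residues modulo `s`. -/
def reducedBox (s : F[X]) : Finset F[X] :=
  (polyBox F s.natDegree).filter fun r => IsCoprime r s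

lemma card_reducedBox {s : F[X]} (hs : s ≠ 0) :
    ((reducedBox s).card : ℝ) =
      (Fintype.card F : ℝ) ^ s.natDegree * ∏ p ∈ primeSet s, sieveFactor p := by
  have hS : ∀ p ∈ primeSet s, Irreducible p ∧ p.Monic := fun p hp =>
    ⟨((mem_primeSet hs).1 hp).1, ((mem_primeSet hs).1 hp).2.1⟩
  rw [← card_sieve (primeSet s) hS 0 1 _ (fun p hp h => (hS p hp).1.not_isUnit
    (isUnit_of_dvd_one h)) (sum_natDegree_le_of_dvd hS hs fun p hp => ((mem_primeSet hs).1 hp).2.2)]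
  congr 2
  ext r
  simp [isCoprime_iff_primeSet hs, reducedBox]

/-- The reduced residues `r` modulo `s` such that `a r` is congruent modulo `s` to a polynomial of
degree less than `deg s - c`. -/
def closeBox (a s : F[X]) (c : ℤ) : Finset F[X] :=
  (reducedBox s).filter fun r => ∃ b : F[X], a * r + b * s = 0 ∨
    ((a * r + b * s).natDegree : ℤ) < s.natDegree - c

/-- Large primes contribute a bounded factor to the sieve. -/
lemma prod_sieveFactor_lower {S : Finset F[X]} (hS : ∀ p ∈ S, Irreducible p) {J : ℕ}
    (hJ : ∀ p ∈ S, J ≤ p.natDegree) (hcard : S.card ≤ Fintype.card F ^ (J + 2)) :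
    Real.exp (-(2 * (Fintype.card F : ℝ) ^ 2)) ≤ ∏ p ∈ S, sieveFactor p := by
  have hq1 : (1 : ℝ) < Fintype.card F := one_lt_card_real
  have hq2 : (2 : ℝ) ≤ Fintype.card F := by exact_mod_cast Fintype.one_lt_card (α := F)
  have hQ : 0 < (Fintype.card F : ℝ) ^ J := by positivity
  calc Real.exp (-(2 * (Fintype.card F : ℝ) ^ 2))
      ≤ Real.exp (-(2 * ((Fintype.card F : ℝ) ^ J)⁻¹)) ^ S.card := by
        rw [← Real.exp_nat_mul, Real.exp_le_exp, mul_neg, neg_le_neg_iff]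
        have : (S.card : ℝ) ≤ (Fintype.card F : ℝ) ^ J * (Fintype.card F : ℝ) ^ 2 := by
          rw [← pow_add]; exact_mod_cast hcard
        have h := mul_le_mul_of_nonneg_right this (inv_nonneg.2 hQ.le)
        rw [mul_right_comm, mul_inv_cancel₀ hQ.ne', one_mul] at h
        linarith
    _ ≤ _ := by
        rw [← Finset.prod_const]
        refine Finset.prod_le_prod (fun _ _ => (Real.exp_pos _).le) fun p hp => ?_
        have h1 : ((Fintype.card F : ℝ) ^ p.natDegree)⁻¹ ≤ 1 / 2 := by
          rw [one_div]
          refine inv_anti₀ two_pos (hq2.trans ?_)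
          exact le_self_pow₀ hq1.le (hS p hp).natDegree_pos.ne'
        refine le_trans ?_ (exp_neg_two_mul_le_one_sub (by positivity) h1)
        rw [Real.exp_le_exp, neg_le_neg_iff]
        gcongr
        · exact hq1.le
        · exact hJ p hp

lemma card_filter_fiber_le {s s' g a' : F[X]} (hs : s ≠ 0) (hg : s = g * s')
    (hco : IsCoprime a' s') (B : Finset F[X]) (hB : B ⊆ reducedBox s) (β : F[X] → F[X])
    (y : F[X]) :
    ((B.filter fun r => a' * r + β r * s' = y).card : ℝ) ≤
      (Fintype.card F : ℝ) ^ g.natDegree *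
        ∏ p ∈ primeSet s with ¬ p ∣ s', sieveFactor p := by
  have hg0 : g ≠ 0 := by rintro rfl; simp [hs] at hg
  have hs'0 : s' ≠ 0 := by rintro rfl; simp [hs] at hg
  rcases Finset.eq_empty_or_nonempty (B.filter fun r => a' * r + β r * s' = y) with h | ⟨r₀, hr₀⟩
  · rw [h, Finset.card_empty, Nat.cast_zero]
    exact mul_nonneg (by positivity) (Finset.prod_nonneg fun p _ => sieveFactor_nonneg p)
  have hT : ∀ p ∈ (primeSet s).filter (fun p => ¬ p ∣ s'), Irreducible p ∧ p.Monic := by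
    intro p hp
    have := (mem_primeSet hs).1 (Finset.mem_filter.1 hp).1
    exact ⟨this.1, this.2.1⟩
  rw [← card_sieve _ hT r₀ s' g.natDegree (fun p hp => (Finset.mem_filter.1 hp).2)
    (sum_natDegree_le_of_dvd hT hg0 ?_)]
  · rw [Finset.mem_filter] at hr₀
    norm_cast
    refine (Finset.card_le_card ?_).trans
      (Finset.card_image_le (f := fun z => r₀ + s' * z))
    intro r hr
    rw [Finset.mem_filter] at hr
    have hrs := hB hr.1
    have hr₀s := hB hr₀.1
    rw [reducedBox, Finset.mem_filter, mem_polyBox] at hrs hr₀s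
    have hdvd : s' ∣ r - r₀ := by
      refine hco.symm.dvd_of_dvd_mul_left ⟨β r₀ - β r, ?_⟩
      linear_combination hr.2 - hr₀.2
    obtain ⟨z, hz⟩ := hdvd
    have hrz : r = r₀ + s' * z := by linear_combination hz
    refine Finset.mem_image.2 ⟨z, ?_, hrz.symm⟩
    rw [Finset.mem_filter, mem_polyBox, ← hrz]
    constructor
    · by_cases hz0 : z = 0
      · simp [hz0]
      have h1 : (s' * z).degree < s.natDegree := by
        rw [← hz]
        exact (degree_sub_le _ _).trans_lt (max_lt hrs.1 hr₀s.1)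
      rw [hg, degree_mul, degree_eq_natDegree hs'0, degree_eq_natDegree hz0,
        natDegree_mul hg0 hs'0] at h1
      rw [degree_eq_natDegree hz0]
      norm_cast at *
      omega
    · intro p hp
      exact (isCoprime_iff_primeSet hs).1 hrs.2 p (Finset.mem_filter.1 hp).1
  · intro p hp
    have h := Finset.mem_filter.1 hp
    have h' := (mem_primeSet hs).1 h.1
    exact (h'.1.prime.dvd_or_dvd (hg ▸ h'.2.2)).resolve_right h.2

omit [Fintype F] in
lemma exists_isCoprime_mul_eq (a : F[X]) {s : F[X]} (hs : s ≠ 0) :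
    ∃ g a' s' : F[X], IsCoprime a' s' ∧ a = g * a' ∧ s = g * s' := by
  obtain ⟨a', ha'⟩ := EuclideanDomain.gcd_dvd_left a s
  obtain ⟨s', hs'⟩ := EuclideanDomain.gcd_dvd_right a s
  have hbez := EuclideanDomain.gcd_eq_gcd_ab a s
  have hg0 : EuclideanDomain.gcd a s ≠ 0 := fun h => hs (EuclideanDomain.gcd_eq_zero_iff.1 h).2
  generalize EuclideanDomain.gcd a s = g at *
  refine ⟨g, a', s', ⟨EuclideanDomain.gcdA a s, EuclideanDomain.gcdB a s, ?_⟩, ha', hs'⟩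
  refine mul_left_cancel₀ hg0 ?_
  linear_combination -hbez - EuclideanDomain.gcdA a s * ha' - EuclideanDomain.gcdB a s * hs'

/-- The proportion of reduced residues modulo `s` in `closeBox a s c` is at most a constant times
`q ^ (-c)`, as long as the range allowed is long enough in terms of the number of prime factors
of `s`. -/
lemma card_closeBox_le {s a : F[X]} (hs : s ≠ 0) (ha : a ≠ 0) (c : ℤ)
    (h : (2 : ℝ) ^ (primeSet s).card ≤
      (Fintype.card F : ℝ) ^ ((s.natDegree : ℤ) - a.natDegree - c)) :
    ((closeBox a s c).card : ℝ) ≤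
      Real.exp (2 * (Fintype.card F : ℝ) ^ 2) * (Fintype.card F : ℝ) ^ (-c) *
        (reducedBox s).card := by
  have hq1 : (1 : ℝ) < Fintype.card F := one_lt_card_real
  have hq0 : (0 : ℝ) < Fintype.card F := zero_lt_one.trans hq1
  obtain ⟨g, a', s', hco, hga, hgs⟩ := exists_isCoprime_mul_eq a hs
  have hg0 : g ≠ 0 := by rintro rfl; simp [hs] at hgs
  have hs'0 : s' ≠ 0 := by rintro rfl; simp [hs] at hgs
  have ha'0 : a' ≠ 0 := by rintro rfl; simp [ha] at hga
  have hdegs : s.natDegree = g.natDegree + s'.natDegree := by rw [hgs, natDegree_mul hg0 hs'0]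
  have hdega : a.natDegree = g.natDegree + a'.natDegree := by rw [hga, natDegree_mul hg0 ha'0]
  have hpos : 0 ≤ (s.natDegree : ℤ) - a.natDegree - c := by
    rw [← zpow_le_zpow_iff_right₀ hq1, zpow_zero]
    exact (one_le_pow₀ one_le_two).trans h
  obtain ⟨H, hH⟩ : ∃ H : ℕ, (H : ℤ) = s'.natDegree - c :=
    ⟨((s'.natDegree : ℤ) - c).toNat, Int.toNat_of_nonneg (by omega)⟩
  have hω : (2 : ℝ) ^ (primeSet s).card ≤ (Fintype.card F : ℝ) ^ H := by
    refine h.trans ?_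
    rw [← zpow_natCast]
    exact zpow_le_zpow_right₀ hq1.le (by omega)
  have hωH : (primeSet s).card ≤ Fintype.card F * H := by
    have h1 : 2 ^ (primeSet s).card ≤ Fintype.card F ^ H := by exact_mod_cast hω
    have h2 : Fintype.card F ^ H ≤ (2 ^ Fintype.card F) ^ H :=
      Nat.pow_le_pow_left Nat.lt_two_pow_self.le H
    rw [← pow_mul] at h2
    exact (Nat.pow_le_pow_iff_right one_lt_two).1 (h1.trans h2)
  set J := Nat.log (Fintype.card F) H with hJdef
  have hHJ : H < Fintype.card F ^ (J + 1) := Nat.lt_pow_succ_log_self Fintype.one_lt_card H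
  set small := (primeSet s').filter fun p => p.natDegree < J with hsmall
  set large := (primeSet s').filter fun p => ¬ p.natDegree < J with hlarge
  set T := (primeSet s).filter fun p => ¬ p ∣ s' with hT
  have hirr : ∀ p ∈ primeSet s', Irreducible p ∧ p.Monic := fun p hp =>
    ⟨((mem_primeSet hs'0).1 hp).1, ((mem_primeSet hs'0).1 hp).2.1⟩
  have hsmirr : ∀ p ∈ small, Irreducible p ∧ p.Monic := fun p hp =>
    hirr p (Finset.mem_filter.1 hp).1
  have hsub : (primeSet s).filter (fun p => p ∣ s') = primeSet s' := by
    ext p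
    rw [Finset.mem_filter, mem_primeSet hs, mem_primeSet hs'0]
    constructor
    · rintro ⟨⟨h1, h2, _⟩, h3⟩; exact ⟨h1, h2, h3⟩
    · rintro ⟨h1, h2, h3⟩; exact ⟨⟨h1, h2, hgs ▸ h3.mul_left g⟩, h3⟩
  have hprod : ∏ p ∈ primeSet s, sieveFactor p =
      (∏ p ∈ small, sieveFactor p) * (∏ p ∈ large, sieveFactor p) *
        ∏ p ∈ T, sieveFactor p := by
    rw [← Finset.prod_filter_mul_prod_filter_not (primeSet s) (fun p => p ∣ s'), hsub,
      ← Finset.prod_filter_mul_prod_filter_not (primeSet s') (fun p => p.natDegree < J)]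
  have hlargeLower : Real.exp (-(2 * (Fintype.card F : ℝ) ^ 2)) ≤
      ∏ p ∈ large, sieveFactor p := by
    refine prod_sieveFactor_lower (J := J) (fun p hp => (hirr p (Finset.mem_filter.1 hp).1).1)
      (fun p hp => not_lt.1 (Finset.mem_filter.1 hp).2) ?_
    calc large.card ≤ (primeSet s').card := Finset.card_filter_le _ _
      _ ≤ (primeSet s).card := by rw [← hsub]; exact Finset.card_filter_le _ _
      _ ≤ Fintype.card F * H := hωH
      _ ≤ Fintype.card F * Fintype.card F ^ (J + 1) := Nat.mul_le_mul_left _ hHJ.le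
      _ = _ := by ring
  have hsmallsum : ∑ p ∈ small, p.natDegree ≤ H := by
    rcases Nat.eq_zero_or_pos H with h0 | h0
    · have : small = ∅ := by
        rw [hsmall, hJdef, h0]; simp
      simp [this]
    · exact (sum_natDegree_le_card_pow small hsmirr J
        fun p hp => (Finset.mem_filter.1 hp).2).trans (Nat.pow_log_le_self _ h0.ne')
  set U := (polyBox F H).filter fun z => ∀ p ∈ small, ¬ p ∣ 0 + 1 * z with hU
  have hUcard := card_sieve small hsmirr 0 1 H
    (fun p hp h => (hsmirr p hp).1.not_isUnit (isUnit_of_dvd_one h)) hsmallsum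
  have hex : ∀ r : F[X], ∃ b : F[X], r ∈ closeBox a s c → (a * r + b * s = 0 ∨
      ((a * r + b * s).natDegree : ℤ) < s.natDegree - c) := by
    intro r
    by_cases hr : r ∈ closeBox a s c
    · obtain ⟨b, hb⟩ := (Finset.mem_filter.1 hr).2
      exact ⟨b, fun _ => hb⟩
    · exact ⟨0, fun h => absurd h hr⟩
  choose β hβ using hex
  have hmaps : ∀ r ∈ closeBox a s c, a' * r + β r * s' ∈ U := by
    intro r hr
    have hrs := hβ r hr
    have hfac : a * r + β r * s = g * (a' * r + β r * s') := by
      rw [hga, hgs]; ring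
    rw [hfac, mul_eq_zero, or_iff_right hg0] at hrs
    rw [hU, Finset.mem_filter, mem_polyBox]
    constructor
    · by_cases h0 : a' * r + β r * s' = 0
      · simp [h0]
      have h2 := hrs.resolve_left h0
      rw [natDegree_mul hg0 h0] at h2
      rw [degree_eq_natDegree h0]
      norm_cast
      omega
    · intro p hp hdvd
      rw [zero_add, one_mul] at hdvd
      have hp' := (mem_primeSet hs'0).1 (Finset.mem_filter.1 hp).1
      have h3 : p ∣ a' * r := (dvd_add_left (hp'.2.2.mul_left (β r))).1 hdvd
      rcases hp'.1.prime.dvd_or_dvd h3 with h4 | h4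
      · exact hp'.1.not_isUnit (hco.isUnit_of_dvd' h4 hp'.2.2)
      · have := (Finset.mem_filter.1 (Finset.mem_filter.1 hr).1).2
        exact hp'.1.not_isUnit (this.isUnit_of_dvd' h4 (hgs ▸ hp'.2.2.mul_left g))
  have hTnn : 0 ≤ ∏ p ∈ T, sieveFactor p := Finset.prod_nonneg fun p _ => sieveFactor_nonneg p
  have hsnn : 0 ≤ ∏ p ∈ small, sieveFactor p := Finset.prod_nonneg fun p _ => sieveFactor_nonneg p
  have hbound : ((closeBox a s c).card : ℝ) ≤
      (U.card : ℝ) * ((Fintype.card F : ℝ) ^ g.natDegree * ∏ p ∈ T, sieveFactor p) := by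
    rw [Finset.card_eq_sum_card_fiberwise hmaps, Nat.cast_sum, ← nsmul_eq_mul]
    exact Finset.sum_le_card_nsmul _ _ _ fun y _ =>
      card_filter_fiber_le hs hgs hco _ (Finset.filter_subset _ _) β y
  refine hbound.trans ?_
  rw [hUcard, card_reducedBox hs, hprod]
  have hexp : (Fintype.card F : ℝ) ^ (-c) * (Fintype.card F : ℝ) ^ s.natDegree =
      (Fintype.card F : ℝ) ^ H * (Fintype.card F : ℝ) ^ g.natDegree := by
    rw [← zpow_natCast, ← zpow_natCast, ← zpow_natCast, ← zpow_add₀ hq0.ne', ← zpow_add₀ hq0.ne']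
    congr 1
    omega
  have hone : 1 ≤ Real.exp (2 * (Fintype.card F : ℝ) ^ 2) * ∏ p ∈ large, sieveFactor p := by
    have h1 := mul_le_mul_of_nonneg_left hlargeLower
      (Real.exp_pos (2 * (Fintype.card F : ℝ) ^ 2)).le
    rwa [← Real.exp_add, add_neg_cancel, Real.exp_zero] at h1
  calc _ = ((Fintype.card F : ℝ) ^ H * (Fintype.card F : ℝ) ^ g.natDegree *
        (∏ p ∈ small, sieveFactor p) * ∏ p ∈ T, sieveFactor p) * 1 := by ring
    _ ≤ ((Fintype.card F : ℝ) ^ H * (Fintype.card F : ℝ) ^ g.natDegree *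
        (∏ p ∈ small, sieveFactor p) * ∏ p ∈ T, sieveFactor p) *
        (Real.exp (2 * (Fintype.card F : ℝ) ^ 2) * ∏ p ∈ large, sieveFactor p) :=
      mul_le_mul_of_nonneg_left hone (by positivity)
    _ = _ := by rw [← hexp]; ring

end Sieve

section AbsoluteValue

variable {Fq}

omit [Fintype Fq] in
lemma coeff_polyEmb (f : Fq[X]) (z : ℤ) :
    (polyEmb Fq f).coeff z = if z ≤ 0 then f.coeff (-z).toNat else 0 := by
  induction f using Polynomial.induction_on' with
  | add f g hf hg =>
    rw [map_add, HahnSeries.coeff_add, hf, hg]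
    split_ifs <;> simp
  | monomial k a =>
    have h : polyEmb Fq (monomial k a) = HahnSeries.single (-(k : ℤ)) a := by
      rw [polyEmb, coe_eval₂RingHom, eval₂_monomial, Yv, HahnSeries.single_pow, HahnSeries.C_apply,
        HahnSeries.single_mul_single]
      simp
    rw [h, HahnSeries.coeff_single, coeff_monomial]
    by_cases hz : z = -(k : ℤ)
    · subst hz; simp
    · rw [if_neg hz]
      split_ifs <;> first | rfl | omega

lemma absv_polyEmb {f : Fq[X]} (hf : f ≠ 0) :
    absv Fq (polyEmb Fq f) = (Fintype.card Fq : ℝ) ^ (f.natDegree : ℤ) := by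
  have hlead : (polyEmb Fq f).coeff (-(f.natDegree : ℤ)) ≠ 0 := by
    rw [coeff_polyEmb, if_pos (by omega)]
    simpa using hf
  have hne : polyEmb Fq f ≠ 0 := by
    intro h
    rw [h] at hlead
    exact hlead HahnSeries.coeff_zero
  have horder : (polyEmb Fq f).order = -(f.natDegree : ℤ) := by
    refine le_antisymm (HahnSeries.order_le_of_coeff_ne_zero hlead) ?_
    refine (HahnSeries.le_order_iff_forall hne).2 fun z hz => ?_
    rw [coeff_polyEmb]
    split_ifs
    · exact coeff_eq_zero_of_natDegree_lt (by omega)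
    · rfl
  rw [absv, if_neg hne, horder, neg_neg]

lemma polyEmb_eq_zero {f : Fq[X]} : polyEmb Fq f = 0 ↔ f = 0 := by
  refine ⟨fun h => ?_, fun h => by rw [h, map_zero]⟩
  by_contra hf
  have h1 := absv_polyEmb hf
  rw [h, absv_zero] at h1
  exact (zpow_pos (zero_lt_one.trans one_lt_card_real) _).ne h1

lemma absv_piv_zpow (z : ℤ) : absv Fq (piv Fq ^ z) = (Fintype.card Fq : ℝ) ^ (-z) := by
  let φ : Kv Fq →*₀ ℝ :=
    { toFun := absv Fq
      map_zero' := absv_zero Fq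
      map_one' := absv_one Fq
      map_mul' := absv_mul Fq }
  have h : φ (piv Fq) = (Fintype.card Fq : ℝ) ^ (-1 : ℤ) := by
    change absv Fq (piv Fq) = _
    rw [absv, piv, if_neg (by simp), HahnSeries.order_single one_ne_zero]
  change φ (piv Fq ^ z) = _
  rw [map_zpow₀, h, ← zpow_mul, neg_one_mul]

/-- Polynomials are discrete: a bound on `π ^ (-k) f` is a bound on the degree of `f`. -/
lemma natDegree_le_of_absv_le {f : Fq[X]} {k l : ℤ}
    (h : absv Fq (piv Fq ^ (-k) * polyEmb Fq f) ≤ (Fintype.card Fq : ℝ) ^ l) :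
    f = 0 ∨ (f.natDegree : ℤ) ≤ l - k := by
  refine or_iff_not_imp_left.2 fun hf => ?_
  have hq : (1 : ℝ) < Fintype.card Fq := one_lt_card_real
  rw [absv_mul, absv_piv_zpow, absv_polyEmb hf, neg_neg,
    ← zpow_add₀ (zero_lt_one.trans hq).ne', zpow_le_zpow_iff_right₀ hq] at h
  omega

end AbsoluteValue

section ShortVectors

variable {Fq n}

omit [Fintype Fq] in
lemma expD_mul_uMat_mulVec (K : Fin n → ℤ) (t x : Fin n → Kv Fq) (i : Fin n) :
    ((expD Fq n K * uMat Fq n t).mulVec x) i =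
      piv Fq ^ (-(K i)) * if i = 0 then x 0 else t i * x 0 + x i := by
  rw [← Matrix.mulVec_mulVec, expD, Matrix.mulVec_diagonal]
  congr 1
  rw [Matrix.mulVec, dotProduct]
  split_ifs with hi
  · rw [Finset.sum_eq_single 0]
    · simp [uMat, hi]
    · intro j _ hj
      simp [uMat, hi, hj, hj.symm]
    · simp
  · rw [Finset.sum_eq_add 0 i (Ne.symm hi)]
    · simp [uMat, hi]
    · intro j _ hj
      simp [uMat, hj.1, Ne.symm hj.2]
    · simp
    · simp

/-- The lattice `exp(K) u_t R_v^n`, where `t = r / s`, has systole at most `q ^ (-m)`. -/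
def HasShortVector (s r : Fin n → Fq[X]) (K : Fin n → ℤ) (m : ℕ) : Prop :=
  ∃ lam : Fin n → Fq[X],
    (fun i => polyEmb Fq (lam i)) ≠ (0 : Fin n → Kv Fq) ∧
    vnorm Fq n ((expD Fq n K * uMat Fq n (tOf Fq n s r)).mulVec fun i => polyEmb Fq (lam i)) ≤
      (Fintype.card Fq : ℝ) ^ (-(m : ℤ))

lemma HasShortVector.exists_denominator {s r : Fin n → Fq[X]} {K : Fin n → ℤ} {m : ℕ}
    (hs : ∀ i, i ≠ 0 → s i ≠ 0) (hK : ∀ i, i ≠ 0 → 0 ≤ K i) (hm : 1 ≤ m)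
    (h : HasShortVector s r K m) :
    ∃ a : Fq[X], a ≠ 0 ∧ (a.natDegree : ℤ) ≤ -m - K 0 ∧ ∀ i, i ≠ 0 →
      ∃ b : Fq[X], a * r i + b * s i = 0 ∨
        ((a * r i + b * s i).natDegree : ℤ) ≤ (s i).natDegree - m - K i := by
  obtain ⟨lam, hlam, hnorm⟩ := h
  have hcoord : ∀ i, absv Fq (((expD Fq n K * uMat Fq n (tOf Fq n s r)).mulVec
      fun i => polyEmb Fq (lam i)) i) ≤ (Fintype.card Fq : ℝ) ^ (-(m : ℤ)) := fun i =>
    (le_ciSup (f := fun i => absv Fq (((expD Fq n K * uMat Fq n (tOf Fq n s r)).mulVec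
      fun i => polyEmb Fq (lam i)) i)) (Set.finite_range _).bddAbove i).trans hnorm
  have htail : ∀ i, i ≠ 0 → lam 0 * r i + lam i * s i = 0 ∨
      ((lam 0 * r i + lam i * s i).natDegree : ℤ) ≤ (s i).natDegree - m - K i := by
    intro i hi
    have h := hcoord i
    have hsi : polyEmb Fq (s i) ≠ 0 := polyEmb_eq_zero.not.2 (hs i hi)
    have hq : (0 : ℝ) < Fintype.card Fq := zero_lt_one.trans one_lt_card_real
    rw [expD_mul_uMat_mulVec, if_neg hi, tOf, if_neg hi] at h
    have h2 := mul_le_mul_of_nonneg_right h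
      (zpow_nonneg hq.le ((s i).natDegree : ℤ))
    rw [← absv_polyEmb (hs i hi), ← absv_mul, absv_polyEmb (hs i hi), ← zpow_add₀ hq.ne',
      mul_assoc] at h2
    have h3 : (polyEmb Fq (r i) / polyEmb Fq (s i) * polyEmb Fq (lam 0) + polyEmb Fq (lam i)) *
        polyEmb Fq (s i) = polyEmb Fq (lam 0 * r i + lam i * s i) := by
      rw [map_add, map_mul, map_mul]
      field_simp
    rw [h3] at h2
    refine (natDegree_le_of_absv_le h2).imp_right fun h => ?_
    omega
  have hhead : lam 0 = 0 ∨ ((lam 0).natDegree : ℤ) ≤ -m - K 0 := by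
    have h := hcoord 0
    rw [expD_mul_uMat_mulVec, if_pos rfl] at h
    exact natDegree_le_of_absv_le h
  have h0 : lam 0 ≠ 0 := by
    intro h0
    apply hlam
    funext i
    change polyEmb Fq (lam i) = 0
    rw [polyEmb_eq_zero]
    by_cases hi : i = 0
    · rw [hi, h0]
    have h := htail i hi
    rw [h0, zero_mul, zero_add, mul_eq_zero, or_iff_left (hs i hi)] at h
    by_contra hne
    have h1 := h.resolve_left hne
    rw [natDegree_mul hne (hs i hi)] at h1
    have := hK i hi
    push_cast at h1
    omega
  exact ⟨lam 0, h0, hhead.resolve_left h0, fun i hi => ⟨lam i, htail i hi⟩⟩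

/-- `Λ_s` as a finite set of representatives. -/
def residues (s : Fin n → Fq[X]) : Finset (Fin n → Fq[X]) :=
  Fintype.piFinset fun i => if i = 0 then {0} else reducedBox (s i)

lemma mem_residues {s r : Fin n → Fq[X]} (hs : ∀ i, i ≠ 0 → s i ≠ 0) :
    r ∈ residues s ↔ r ∈ Tset Fq n s := by
  rw [residues, Fintype.mem_piFinset, Tset, Set.mem_ofPred_eq]
  constructor
  · intro h
    refine ⟨by simpa using h 0, fun i hi => ?_⟩
    have := h i
    rw [if_neg hi, reducedBox, Finset.mem_filter, mem_polyBox,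
      ← degree_eq_natDegree (hs i hi)] at this
    exact this.symm
  · rintro ⟨h0, h⟩ i
    split_ifs with hi
    · simp [hi, h0]
    · rw [reducedBox, Finset.mem_filter, mem_polyBox, ← degree_eq_natDegree (hs i hi)]
      exact (h i hi).symm

omit [Fintype Fq] in
lemma card_piFinset_tail (A : Fin n → Finset Fq[X]) :
    (Fintype.piFinset fun i => if i = 0 then {0} else A i).card =
      ∏ i ∈ Finset.univ.erase 0, (A i).card := by
  rw [Fintype.card_piFinset, ← Finset.mul_prod_erase _ _ (Finset.mem_univ 0), if_pos rfl,
    Finset.card_singleton, one_mul]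
  exact Finset.prod_congr rfl fun i hi => by rw [if_neg (Finset.ne_of_mem_erase hi)]

lemma prod_zpow_eq_zpow_sum {ι : Type*} (S : Finset ι) {x : ℝ} (hx : x ≠ 0) (f : ι → ℤ) :
    ∏ i ∈ S, x ^ f i = x ^ ∑ i ∈ S, f i := by
  induction S using Finset.induction_on with
  | empty => simp
  | insert a S ha ih => rw [Finset.prod_insert ha, Finset.sum_insert ha, ih, zpow_add₀ hx]

lemma card_erase_polyBox_le (z : ℤ) :
    (((polyBox Fq z.toNat).erase 0).card : ℝ) ≤ (Fintype.card Fq : ℝ) ^ z := by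
  rcases le_or_gt z 0 with hz | hz
  · have : (polyBox Fq z.toNat).erase 0 = ∅ := by
      ext p
      simp [mem_polyBox, Int.toNat_of_nonpos hz]
    rw [this, Finset.card_empty, Nat.cast_zero]
    positivity
  · refine (Nat.cast_le.2 (Finset.card_erase_le)).trans ?_
    rw [card_polyBox]
    push_cast
    rw [← zpow_natCast, Int.toNat_of_nonneg hz.le]

/-- The constant in the non-escape of mass estimate. -/
def massConst (q n : ℕ) : ℝ := Real.exp (2 * (q : ℝ) ^ 2) ^ n * (q : ℝ) ^ (n * n)

lemma card_hasShortVector_le {s : Fin n → Fq[X]} (hs : ∀ i, i ≠ 0 → s i ≠ 0) {K : Fin n → ℤ}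
    (hsum : ∑ i, K i = 0) (hK : ∀ i, i ≠ 0 → 0 ≤ K i) {m : ℕ} (hm : 1 ≤ m)
    (hgood : ∀ i, i ≠ 0 → (2 : ℝ) ^ omegaP Fq (s i) ≤
      (Fintype.card Fq : ℝ) ^ (((s i).natDegree : ℤ) + K 0 - K i + n)) :
    (((residues s).filter fun r => HasShortVector s r K m).card : ℝ) ≤
      massConst (Fintype.card Fq) n * (Fintype.card Fq : ℝ) ^ (-((m : ℤ) * (n : ℤ))) *
        (residues s).card := by
  have hq1 : (1 : ℝ) < Fintype.card Fq := one_lt_card_real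
  have hq0 : (0 : ℝ) < Fintype.card Fq := zero_lt_one.trans hq1
  have hn : 1 ≤ n := Nat.one_le_iff_ne_zero.2 (NeZero.ne n)
  set q : ℝ := (Fintype.card Fq : ℝ) with hqdef
  set E := Real.exp (2 * q ^ 2) with hE
  set A := (polyBox Fq (1 - m - K 0 : ℤ).toNat).erase 0 with hA
  have hE1 : 1 ≤ E := Real.one_le_exp (by positivity)
  have hsub : ((residues s).filter fun r => HasShortVector s r K m) ⊆
      A.biUnion fun a => Fintype.piFinset fun i =>
        if i = 0 then {0} else closeBox a (s i) (m + K i - n) := by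
    intro r hr
    rw [Finset.mem_filter] at hr
    obtain ⟨a, ha0, hadeg, ha⟩ := hr.2.exists_denominator hs hK hm
    rw [Finset.mem_biUnion]
    refine ⟨a, ?_, ?_⟩
    · rw [hA, Finset.mem_erase, mem_polyBox, degree_eq_natDegree ha0]
      exact ⟨ha0, Nat.cast_lt.2 (by omega)⟩
    · have hr1 := hr.1
      rw [residues, Fintype.mem_piFinset] at hr1
      rw [Fintype.mem_piFinset]
      intro i
      have h := hr1 i
      split_ifs with hi
      · rwa [if_pos hi] at h
      · rw [if_neg hi] at h
        obtain ⟨b, hb⟩ := ha i hi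
        refine Finset.mem_filter.2 ⟨h, b, hb.imp_right fun hb => ?_⟩
        omega
  have hterm : ∀ a ∈ A, ((Fintype.piFinset fun i =>
        if i = 0 then {0} else closeBox a (s i) (m + K i - n)).card : ℝ) ≤
      E ^ (n - 1) * q ^ (((n : ℤ) - 1) * (n - m) + K 0) * (residues s).card := by
    intro a ha
    have ha0 : a ≠ 0 := Finset.ne_of_mem_erase ha
    have hadeg : a.natDegree < (1 - m - K 0 : ℤ).toNat := by
      rw [hA, Finset.mem_erase, mem_polyBox, degree_eq_natDegree ha0] at ha
      exact Nat.cast_lt.1 ha.2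
    rw [residues, card_piFinset_tail, card_piFinset_tail, Nat.cast_prod, Nat.cast_prod]
    calc ∏ i ∈ Finset.univ.erase 0, ((closeBox a (s i) (m + K i - n)).card : ℝ)
        ≤ ∏ i ∈ Finset.univ.erase (0 : Fin n),
            E * q ^ (-((m : ℤ) + K i - n)) * (reducedBox (s i)).card := by
          refine Finset.prod_le_prod (fun _ _ => Nat.cast_nonneg _) fun i hi => ?_
          have hi0 := Finset.ne_of_mem_erase hi
          refine card_closeBox_le (hs i hi0) ha0 _ ((hgood i hi0).trans ?_)
          exact zpow_le_zpow_right₀ hq1.le (by omega)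
      _ = _ := by
          rw [Finset.prod_mul_distrib, Finset.prod_mul_distrib, Finset.prod_const,
            prod_zpow_eq_zpow_sum _ hq0.ne', Finset.card_erase_of_mem (Finset.mem_univ _),
            Finset.card_univ, Fintype.card_fin]
          congr 3
          have h1 := Finset.add_sum_erase Finset.univ K (Finset.mem_univ 0)
          rw [hsum] at h1
          rw [Finset.sum_neg_distrib, Finset.sum_sub_distrib, Finset.sum_add_distrib,
            Finset.sum_const, Finset.sum_const, Finset.card_erase_of_mem (Finset.mem_univ _),
            Finset.card_univ, Fintype.card_fin, nsmul_eq_mul, nsmul_eq_mul, Nat.cast_sub hn,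
            Nat.cast_one]
          linear_combination -h1
  have hφ : (0 : ℝ) ≤ (residues s).card := Nat.cast_nonneg _
  calc (((residues s).filter fun r => HasShortVector s r K m).card : ℝ)
      ≤ ∑ a ∈ A, ((Fintype.piFinset fun i =>
        if i = 0 then {0} else closeBox a (s i) (m + K i - n)).card : ℝ) := by
        exact_mod_cast (Finset.card_le_card hsub).trans Finset.card_biUnion_le
    _ ≤ A.card * (E ^ (n - 1) * q ^ (((n : ℤ) - 1) * (n - m) + K 0) * (residues s).card) := by
        rw [← nsmul_eq_mul]
        exact Finset.sum_le_card_nsmul _ _ _ hterm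
    _ ≤ q ^ (1 - m - K 0 : ℤ) *
          (E ^ (n - 1) * q ^ (((n : ℤ) - 1) * (n - m) + K 0) * (residues s).card) :=
        mul_le_mul_of_nonneg_right (card_erase_polyBox_le _) (by positivity)
    _ = E ^ (n - 1) * (q ^ (1 - m - K 0 : ℤ) * q ^ (((n : ℤ) - 1) * (n - m) + K 0)) *
          (residues s).card := by ring
    _ ≤ E ^ n * (q ^ (n * n) * q ^ (-((m : ℤ) * (n : ℤ)))) * (residues s).card := by
        have h1 : q ^ (1 - m - K 0 : ℤ) * q ^ (((n : ℤ) - 1) * (n - m) + K 0) ≤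
            q ^ (n * n) * q ^ (-((m : ℤ) * (n : ℤ))) := by
          rw [← zpow_natCast q (n * n), ← zpow_add₀ hq0.ne', ← zpow_add₀ hq0.ne']
          refine zpow_le_zpow_right₀ hq1.le ?_
          push_cast
          have : (1 : ℤ) ≤ n := by exact_mod_cast hn
          linarith
        have h2 : E ^ (n - 1) ≤ E ^ n := pow_le_pow_right₀ hE1 (Nat.sub_le _ _)
        gcongr
    _ = _ := by rw [massConst]; ring

lemma one_le_massConst {q : ℕ} (hq : 1 ≤ q) (n : ℕ) : 1 ≤ massConst q n := by
  have h1 : (1 : ℝ) ≤ q := by exact_mod_cast hq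
  exact one_le_mul_of_one_le_of_one_le (one_le_pow₀ (Real.one_le_exp (by positivity)))
    (one_le_pow₀ h1)

end ShortVectors

lemma card_filter_sub_lt_le (N : ℕ) (κ : ℝ) :
    (((Finset.range N).filter fun j : ℕ => (N : ℝ) - j < κ).card : ℝ) ≤ max κ 0 := by
  have h : ((Finset.range N).filter fun j : ℕ => (N : ℝ) - j < κ).card ≤ ⌊κ⌋₊ := by
    calc _ ≤ (Finset.Icc 1 ⌊κ⌋₊).card := by
          refine Finset.card_le_card_of_injOn (fun j => N - j) ?_ ?_
          · intro j hj
            rw [Finset.mem_coe, Finset.mem_filter, Finset.mem_range] at hj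
            rw [Finset.mem_coe, Finset.mem_Icc]
            refine ⟨Nat.sub_pos_of_lt hj.1, Nat.le_floor ?_⟩
            rw [Nat.cast_sub hj.1.le]
            exact hj.2.le
          · intro i hi j hj hij
            rw [Finset.mem_coe, Finset.mem_filter, Finset.mem_range] at hi hj
            have h : N - i = N - j := hij
            omega
      _ = _ := by simp
  refine (Nat.cast_le.2 h).trans ?_
  rcases le_total 0 κ with h0 | h0
  · exact (Nat.floor_le h0).trans (le_max_left _ _)
  · rw [Nat.floor_of_nonpos h0, Nat.cast_zero]
    exact le_max_right _ _

/-- The defining property of `κ'(s)`: an exponent of at least `n κ'(s)` compensates for the number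
of prime factors of every `s_i`. -/
lemma two_pow_omegaP_le (hn : 2 ≤ n) (s : Fin n → Fq[X]) {i : Fin n} (hi : i ≠ 0) {d : ℤ}
    (hd : kappa' Fq n hn s ≤ d) :
    (2 : ℝ) ^ omegaP Fq (s i) ≤
      (Fintype.card Fq : ℝ) ^ (((s i).natDegree : ℤ) - degStar Fq n s + n * d) := by
  have hq1 : (1 : ℝ) < Fintype.card Fq := one_lt_card_real
  have hq0 : (0 : ℝ) < Fintype.card Fq := zero_lt_one.trans hq1
  have hn0 : (0 : ℝ) < n := by exact_mod_cast (by omega : 0 < n)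
  have hsup := Finset.le_sup' (fun i => Real.logb (Fintype.card Fq)
      ((2 : ℝ) ^ (omegaP Fq (s i)) *
          max 1 (Real.log (Real.log ((Fintype.card Fq : ℝ) ^ (s i).natDegree))) /
        (Fintype.card Fq : ℝ) ^ (s i).natDegree)) (Finset.mem_erase.2 ⟨hi, Finset.mem_univ i⟩)
  rw [kappa', tailSup, one_div, inv_mul_le_iff₀ hn0] at hd
  have h1 : Real.logb (Fintype.card Fq) ((2 : ℝ) ^ (omegaP Fq (s i)) /
      (Fintype.card Fq : ℝ) ^ (s i).natDegree) ≤ n * d - degStar Fq n s := by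
    refine le_trans (Real.logb_le_logb_of_le hq1 (by positivity) ?_)
      (hsup.trans (by linarith))
    gcongr
    exact le_mul_of_one_le_right (by positivity) (le_max_left _ _)
  rw [Real.logb_le_iff_le_rpow hq1 (by positivity), div_le_iff₀ (by positivity)] at h1
  refine h1.trans_eq ?_
  rw [← Real.rpow_natCast _ (s i).natDegree, ← Real.rpow_add hq0, ← Real.rpow_intCast]
  congr 1
  push_cast
  ring

/-- **Corollary 7.4 of the paper** (non-escape of mass along an interval of the diagonal
orbit, for `R_v = F_q[Y]`, which is principal): there is `c₂ ≥ 1` such that for every `s`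
satisfying the divisibility-chain condition with `v(s_*) ∈ nℤ`, every `k ∈ ◊_s` with
`k + (N-1)w ∈ ◊_s`, and every `m ≥ 1` with `N ≥ κ'(s)/(c₂ q^{-mn})`, the number of pairs
`(t,j) ∈ Λ_s × {0,…,N-1}` such that `exp(k+jw) u_t R_v^n` has systole `≤ q^{-m}` is at most
`2 c₂ q^{-mn} N Card Λ_s`. -/
theorem no_escape_of_mass_on_intervals (hn : 2 ≤ n) :
    ∃ c₂ : ℝ, 1 ≤ c₂ ∧
      ∀ s : Fin n → Polynomial Fq, (∀ i : Fin n, i ≠ 0 → s i ≠ 0) →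
      ChainCond Fq n s → (n : ℤ) ∣ vstar Fq n s →
      ∀ k : Fin n → ℤ, k ∈ diamondSet Fq n s →
      ∀ N : ℕ, 1 ≤ N → (k + (N - 1) • wvec n) ∈ diamondSet Fq n s →
      ∀ m : ℕ, 1 ≤ m →
      kappa' Fq n hn s / (c₂ * (Fintype.card Fq : ℝ) ^ (-((m : ℤ) * (n : ℤ)))) ≤ (N : ℝ) →
      (Nat.card {p : (Fin n → Polynomial Fq) × ℕ // p.1 ∈ Tset Fq n s ∧ p.2 < N ∧
          ∃ lam : Fin n → Polynomial Fq,
            (fun i => polyEmb Fq (lam i)) ≠ (0 : Fin n → Kv Fq) ∧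
            vnorm Fq n ((expD Fq n (k + p.2 • wvec n) *
                uMat Fq n (tOf Fq n s p.1)).mulVec fun i => polyEmb Fq (lam i)) ≤
              (Fintype.card Fq : ℝ) ^ (-(m : ℤ))} : ℝ) ≤
        2 * c₂ * (Fintype.card Fq : ℝ) ^ (-((m : ℤ) * (n : ℤ))) * (N : ℝ) *
          (Nat.card (Tset Fq n s) : ℝ) := by
  refine ⟨massConst (Fintype.card Fq) n, one_le_massConst Fintype.card_pos n, ?_⟩
  intro s hs _ _ k hk N hN hkN m hm hκ
  have hq0 : (0 : ℝ) < Fintype.card Fq := zero_lt_one.trans one_lt_card_real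
  have hc1 := one_le_massConst (Fintype.card_pos (α := Fq)) n
  set c := massConst (Fintype.card Fq) n with hc
  set ε := (Fintype.card Fq : ℝ) ^ (-((m : ℤ) * (n : ℤ))) with hε
  have hε0 : 0 < ε := zpow_pos hq0 _
  have hcε : 0 < c * ε := mul_pos (zero_lt_one.trans_le hc1) hε0
  rw [div_le_iff₀ hcε] at hκ
  have hcardT : Nat.card (Tset Fq n s) = (residues s).card :=
    Nat.subtype_card _ fun r => mem_residues hs
  set B : ℕ → Finset (Fin n → Fq[X]) := fun j =>
    (residues s).filter fun r => HasShortVector s r (k + j • wvec n) m with hB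
  have hcount : Nat.card {p : (Fin n → Polynomial Fq) × ℕ // p.1 ∈ Tset Fq n s ∧ p.2 < N ∧
      HasShortVector s p.1 (k + p.2 • wvec n) m} ≤ ∑ j ∈ Finset.range N, (B j).card := by
    rw [Nat.subtype_card ((Finset.range N).biUnion fun j => (B j).image fun r => (r, j))]
    · exact Finset.card_biUnion_le.trans (Finset.sum_le_sum fun j _ => Finset.card_image_le)
    · rintro ⟨r, j⟩
      simp only [hB, Finset.mem_biUnion, Finset.mem_range, Finset.mem_image, Finset.mem_filter,
        mem_residues hs, Prod.mk.injEq]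
      constructor
      · rintro ⟨_, hj, _, ⟨hr, hshort⟩, rfl, rfl⟩
        exact ⟨hr, hj, hshort⟩
      · rintro ⟨hr, hj, hshort⟩
        exact ⟨j, hj, r, ⟨hr, hshort⟩, rfl, rfl⟩
  have hw : ∑ i, wvec n i = 0 := by
    have h : ∀ i ∈ Finset.univ.erase (0 : Fin n), wvec n i = 1 := fun i hi =>
      if_neg (Finset.ne_of_mem_erase hi)
    rw [← Finset.add_sum_erase _ _ (Finset.mem_univ 0), Finset.sum_congr rfl h, wvec, if_pos rfl,
      Finset.sum_const,
      Finset.card_erase_of_mem (Finset.mem_univ _), Finset.card_univ, Fintype.card_fin,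
      nsmul_eq_mul, Nat.cast_sub (by omega)]
    push_cast
    ring
  have hhead : ∀ j : ℕ, (k + j • wvec n) 0 = k 0 + j * (1 - n) := fun j => by
    rw [Pi.add_apply, Pi.smul_apply, wvec, if_pos rfl, nsmul_eq_mul]
  have htail : ∀ (j : ℕ) (i : Fin n), i ≠ 0 → (k + j • wvec n) i = k i + j := fun j i hi => by
    rw [Pi.add_apply, Pi.smul_apply, wvec, if_neg hi, nsmul_eq_mul, mul_one]
  have hBj : ∀ j ∈ Finset.range N, ((B j).card : ℝ) ≤ c * ε * (residues s).card +
      if (N : ℝ) - j < kappa' Fq n hn s then ((residues s).card : ℝ) else 0 := by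
    intro j hj
    rw [Finset.mem_range] at hj
    split_ifs with hbad
    · have h1 : ((B j).card : ℝ) ≤ (residues s).card :=
        Nat.cast_le.2 (Finset.card_filter_le _ _)
      have h2 : 0 ≤ c * ε * (residues s).card := by positivity
      linarith
    · rw [add_zero]
      have hd : kappa' Fq n hn s ≤ ((N - j : ℤ) : ℝ) := by
        push_cast
        exact not_lt.1 hbad
      refine card_hasShortVector_le hs ?_ ?_ hm ?_
      · simp only [Pi.add_apply, Pi.smul_apply, Finset.sum_add_distrib, ← Finset.smul_sum, hw,
          hk.1, smul_zero, add_zero]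
      · intro i hi
        have := (hk.2 i hi).1
        rw [htail j i hi]
        positivity
      · intro i hi
        refine (two_pow_omegaP_le Fq n hn s hi hd).trans
          (zpow_le_zpow_right₀ one_lt_card_real.le ?_)
        have h := (hkN.2 i hi).2
        rw [hhead, htail _ i hi, vstar, Nat.cast_sub hN, Nat.cast_one] at h
        rw [hhead, htail _ i hi]
        linarith
  have hκ' : max (kappa' Fq n hn s) 0 ≤ c * ε * N := by
    refine max_le (by linarith) (by positivity)
  calc _ ≤ ((∑ j ∈ Finset.range N, (B j).card : ℕ) : ℝ) := Nat.cast_le.2 hcount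
    _ ≤ ∑ j ∈ Finset.range N, (c * ε * (residues s).card +
        if (N : ℝ) - j < kappa' Fq n hn s then ((residues s).card : ℝ) else 0) := by
      rw [Nat.cast_sum]
      exact Finset.sum_le_sum hBj
    _ = N * (c * ε * (residues s).card) + (((Finset.range N).filter
          fun j : ℕ => (N : ℝ) - j < kappa' Fq n hn s).card : ℝ) * (residues s).card := by
      rw [Finset.sum_add_distrib, Finset.sum_const, Finset.card_range, nsmul_eq_mul,
        ← Finset.sum_filter, Finset.sum_const, nsmul_eq_mul]
    _ ≤ N * (c * ε * (residues s).card) + c * ε * N * (residues s).card := by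
      have := (card_filter_sub_lt_le N (kappa' Fq n hn s)).trans hκ'
      gcongr
    _ = _ := by
      rw [hcardT]
      ring
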